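/- Let X be a topological space. The penalty function F_λ is (globally) exact if and only if the following two conditions hold: (1) F_μ is bounded below on A for some μ ≥ 0; (2) F_λ is exact on Ω_δ for some δ > 0. Moreover, in that case λ*(f, φ) ≤ max{λ*(Ω_δ), μ + (f* − c)/δ}, where c = inf_{x∈A} F_μ(x). -/

import Mathlib

open Filter Topology Set

/-- The linear penalty function `F_λ = f + λ φ`. -/
noncomputable def penaltyFun {X : Type*} (f : X → EReal) (φ : X → ℝ) (lam : ℝ) : X → EReal :=
  fun x => f x + ((lam * φ x : ℝ) : EReal)

/-- The penalty function `F_λ` is globally exact. -/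
def GloballyExact {X : Type*} (f : X → EReal) (φ : X → ℝ) (A M : Set X) : Prop :=
  ∃ lam0 : ℝ, 0 ≤ lam0 ∧ ∀ lam : ℝ, lam0 < lam →
    {x | x ∈ A ∧ ∀ y ∈ A, penaltyFun f φ lam x ≤ penaltyFun f φ lam y} =
      {x | x ∈ M ∩ A ∧ ∀ y ∈ M ∩ A, f x ≤ f y}

/-- The least exact penalty parameter `λ*(f, φ)`. -/
noncomputable def leastGlobalExactParam {X : Type*} (f : X → EReal) (φ : X → ℝ)
    (A M : Set X) : ℝ :=
  sInf {lam0 : ℝ | 0 ≤ lam0 ∧ ∀ lam : ℝ, lam0 < lam →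
    {x | x ∈ A ∧ ∀ y ∈ A, penaltyFun f φ lam x ≤ penaltyFun f φ lam y} =
      {x | x ∈ M ∩ A ∧ ∀ y ∈ M ∩ A, f x ≤ f y}}

/-- The penalty function `F_λ` is exact on the set `C` (relative to the optimal value
`fstar` of the problem `(𝒫)`). -/
def ExactOnSet {X : Type*} (f : X → EReal) (φ : X → ℝ) (fstar : EReal) (C : Set X) : Prop :=
  ∃ ls : ℝ, 0 ≤ ls ∧ ∀ lam : ℝ, ls ≤ lam → ∀ x ∈ C, fstar ≤ penaltyFun f φ lam x

/-- The least exact penalty parameter `λ*(C)` of `F_λ` on the set `C`. -/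
noncomputable def leastExactOnParam {X : Type*} (f : X → EReal) (φ : X → ℝ)
    (fstar : EReal) (C : Set X) : ℝ :=
  sInf {ls : ℝ | 0 ≤ ls ∧ ∀ lam : ℝ, ls ≤ lam → ∀ x ∈ C, fstar ≤ penaltyFun f φ lam x}

theorem penaltyFun_mono {X : Type*} (f : X → EReal) {φ : X → ℝ} {s t : ℝ} (hst : s ≤ t)
    {x : X} (hx : 0 ≤ φ x) : penaltyFun f φ s x ≤ penaltyFun f φ t x :=
  add_le_add_right (EReal.coe_le_coe_iff.2 (mul_le_mul_of_nonneg_right hst hx)) (f x)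

theorem penaltyFun_of_eq_zero {X : Type*} (f : X → EReal) {φ : X → ℝ} (s : ℝ) {x : X}
    (hx : φ x = 0) : penaltyFun f φ s x = f x := by
  simp [penaltyFun, hx]

/-- If the optimal value is a lower bound of `F_s` on `A`, then for every `t > s` the penalized
and the constrained problems have the same minimizers. -/
theorem minimizers_penaltyFun_eq {X : Type*} {f : X → EReal} {φ : X → ℝ} {A : Set X}
    (hfbot : ∀ x, f x ≠ ⊥) (hφnn : ∀ x, 0 ≤ φ x) {xstar : X} (hφ : φ xstar = 0)
    (hA : xstar ∈ A) (hfinite : f xstar ≠ ⊤) {s t : ℝ} (hst : s < t)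
    (hs : ∀ x ∈ A, f xstar ≤ penaltyFun f φ s x) :
    {x | x ∈ A ∧ ∀ y ∈ A, penaltyFun f φ t x ≤ penaltyFun f φ t y} =
      {x | x ∈ {x | φ x = 0} ∩ A ∧ ∀ y ∈ {x | φ x = 0} ∩ A, f x ≤ f y} := by
  ext x
  constructor
  · rintro ⟨hxA, hx⟩
    have h1 := hx xstar hA
    rw [penaltyFun_of_eq_zero f t hφ] at h1
    have h2 := h1.trans (hs x hxA)
    have hx0 : φ x = 0 := by
      have hfx : f x ≠ ⊤ := by
        intro h
        apply hfinite
        simpa [penaltyFun, h, -EReal.coe_mul] using h1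
      unfold penaltyFun at h2
      lift f x to ℝ using ⟨hfx, hfbot x⟩ with r
      norm_cast at h2
      nlinarith [hφnn x]
    refine ⟨⟨hx0, hxA⟩, fun y hy => ?_⟩
    have h := hx y hy.2
    rwa [penaltyFun_of_eq_zero f t hx0, penaltyFun_of_eq_zero f t hy.1] at h
  · rintro ⟨⟨hx0, hxA⟩, hx⟩
    refine ⟨hxA, fun y hy => ?_⟩
    rw [penaltyFun_of_eq_zero f t hx0]
    exact (hx xstar ⟨hφ, hA⟩).trans ((hs y hy).trans (penaltyFun_mono f hst.le (hφnn y)))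

/-- Where `φ ≥ δ`, a lower bound `c` of `F_μ` becomes the lower bound `a` of `F_t` as soon as
`t ≥ μ + (a - c) / δ`. -/
theorem le_penaltyFun_of_le {X : Type*} {f : X → EReal} {φ : X → ℝ} {x : X}
    (hfbot : f x ≠ ⊥) {μ a c δ t : ℝ} (hδ : 0 < δ) (hca : c ≤ a)
    (hc : (c : EReal) ≤ penaltyFun f φ μ x) (hx : δ ≤ φ x) (ht : μ + (a - c) / δ ≤ t) :
    (a : EReal) ≤ penaltyFun f φ t x := by
  unfold penaltyFun at hc ⊢
  by_cases hfx : f x = ⊤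
  · simp [hfx, -EReal.coe_mul]
  lift f x to ℝ using ⟨hfx, hfbot⟩ with r
  norm_cast at hc ⊢
  have h1 : (a - c) / δ ≤ t - μ := by linarith
  have h2 : 0 ≤ t - μ := (div_nonneg (sub_nonneg.2 hca) hδ.le).trans h1
  rw [div_le_iff₀ hδ] at h1
  nlinarith [mul_le_mul_of_nonneg_left hx h2]

theorem leastExactOnParam_nonneg {X : Type*} (f : X → EReal) (φ : X → ℝ) (a : EReal)
    (C : Set X) : 0 ≤ leastExactOnParam f φ a C :=
  Real.sInf_nonneg fun _ h => h.1

theorem le_penaltyFun_of_leastExactOnParam_lt {X : Type*} {f : X → EReal} {φ : X → ℝ}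
    {a : EReal} {C : Set X} (h : ExactOnSet f φ a C) {t : ℝ}
    (ht : leastExactOnParam f φ a C < t) {x : X} (hx : x ∈ C) : a ≤ penaltyFun f φ t x := by
  obtain ⟨s, hs, hst⟩ := exists_lt_of_csInf_lt h ht
  exact hs.2 t hst.le x hx

/-- Exactness on `{x ∈ A | φ x < δ}` and a lower bound `c` of `F_μ` on `A` give an explicit
threshold for global exactness. -/
theorem minimizers_penaltyFun_eq_of_max_lt {X : Type*} {f : X → EReal} {φ : X → ℝ} {A : Set X}
    (hfbot : ∀ x, f x ≠ ⊥) (hφnn : ∀ x, 0 ≤ φ x) {xstar : X} (hφ : φ xstar = 0)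
    (hA : xstar ∈ A) {a : ℝ} (ha : f xstar = a) {μ c δ : ℝ} (hδ : 0 < δ)
    (hc : ∀ x ∈ A, (c : EReal) ≤ penaltyFun f φ μ x)
    (hex : ExactOnSet f φ a {x | x ∈ A ∧ φ x < δ}) {t : ℝ}
    (ht : max (leastExactOnParam f φ a {x | x ∈ A ∧ φ x < δ}) (μ + (a - c) / δ) < t) :
    {x | x ∈ A ∧ ∀ y ∈ A, penaltyFun f φ t x ≤ penaltyFun f φ t y} =
      {x | x ∈ {x | φ x = 0} ∩ A ∧ ∀ y ∈ {x | φ x = 0} ∩ A, f x ≤ f y} := by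
  obtain ⟨s, hs, hst⟩ := exists_between ht
  have hca : c ≤ a := by
    have h := hc xstar hA
    rwa [penaltyFun_of_eq_zero f μ hφ, ha, EReal.coe_le_coe_iff] at h
  refine minimizers_penaltyFun_eq hfbot hφnn hφ hA (ha ▸ EReal.coe_ne_top a) hst
    fun x hx => ?_
  rw [ha]
  rcases lt_or_ge (φ x) δ with hlt | hge
  · exact le_penaltyFun_of_leastExactOnParam_lt hex ((le_max_left _ _).trans_lt hs) ⟨hx, hlt⟩
  · exact le_penaltyFun_of_le (hfbot x) hδ hca (hc x hx) hge ((le_max_right _ _).trans hs.le)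

/-- Lemma on exactness of a penalty function: `F_λ` is globally exact iff `F_μ` is bounded
below on `A` for some `μ ≥ 0` and `F_λ` is exact on `Ω_δ = {x ∈ A | φ(x) < δ}` for some
`δ > 0`; moreover `λ*(f, φ) ≤ max{λ*(Ω_δ), μ + (f* - c)/δ}` with `c = inf_A F_μ`. -/
theorem globallyExact_iff_boundedBelow_and_exactOn {X : Type*} [TopologicalSpace X]
    (f : X → EReal) (φ : X → ℝ) (A M : Set X)
    (hAne : A.Nonempty) (hMne : M.Nonempty)
    (hfbot : ∀ x, f x ≠ ⊥) (hφnn : ∀ x, 0 ≤ φ x) (hMdef : M = {x | φ x = 0})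
    (xstar : X) (hxstar : xstar ∈ M ∩ A) (hmin : ∀ y ∈ M ∩ A, f xstar ≤ f y)
    (hfinite : f xstar ≠ ⊤) :
    (GloballyExact f φ A M ↔
      ((∃ μ : ℝ, 0 ≤ μ ∧ ∃ c : ℝ, ∀ x ∈ A, (c : EReal) ≤ penaltyFun f φ μ x) ∧
        (∃ δ : ℝ, 0 < δ ∧ ExactOnSet f φ (f xstar) {x | x ∈ A ∧ φ x < δ}))) ∧
    (∀ μ : ℝ, 0 ≤ μ → (∃ c : ℝ, ∀ x ∈ A, (c : EReal) ≤ penaltyFun f φ μ x) →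
      ∀ δ : ℝ, 0 < δ → ExactOnSet f φ (f xstar) {x | x ∈ A ∧ φ x < δ} →
        (leastGlobalExactParam f φ A M : EReal) ≤
          max ((leastExactOnParam f φ (f xstar) {x | x ∈ A ∧ φ x < δ} : ℝ) : EReal)
            ((μ : EReal) +
              (f xstar - ⨅ x ∈ A, penaltyFun f φ μ x) / ((δ : ℝ) : EReal))) := by
  subst hMdef
  obtain ⟨hφ, hA⟩ := hxstar
  obtain ⟨a, ha⟩ : ∃ a : ℝ, f xstar = a :=
    ⟨_, (EReal.coe_toReal hfinite (hfbot xstar)).symm⟩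
  rw [ha] at hmin ⊢
  refine ⟨⟨?_, ?_⟩, ?_⟩
  · rintro ⟨t, ht, h⟩
    have hx : xstar ∈ {x | x ∈ A ∧ ∀ y ∈ A,
        penaltyFun f φ (t + 1) x ≤ penaltyFun f φ (t + 1) y} := by
      rw [h (t + 1) (by linarith)]
      exact ⟨⟨hφ, hA⟩, fun y hy => ha.symm ▸ hmin y hy⟩
    have hle : ∀ x ∈ A, (a : EReal) ≤ penaltyFun f φ (t + 1) x := fun x hxA => by
      rw [← ha, ← penaltyFun_of_eq_zero f (t + 1) hφ]
      exact hx.2 x hxA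
    exact ⟨⟨t + 1, by linarith, a, hle⟩, 1, one_pos, t + 1, by linarith,
      fun s hs x hxC => (hle x hxC.1).trans (penaltyFun_mono f hs (hφnn x))⟩
  · rintro ⟨⟨μ, hμ, c, hc⟩, δ, hδ, hex⟩
    exact ⟨_, le_max_of_le_left (leastExactOnParam_nonneg f φ a _), fun t ht =>
      minimizers_penaltyFun_eq_of_max_lt hfbot hφnn hφ hA ha hδ hc hex ht⟩
  · rintro μ hμ ⟨c₀, hc₀⟩ δ hδ hex
    obtain ⟨c, hc⟩ : ∃ c : ℝ, ⨅ x ∈ A, penaltyFun f φ μ x = c := by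
      refine ⟨_, (EReal.coe_toReal (ne_top_of_le_ne_top (EReal.coe_ne_top a) ?_)
        (ne_bot_of_le_ne_bot (EReal.coe_ne_bot c₀) (le_iInf₂ hc₀))).symm⟩
      rw [← ha, ← penaltyFun_of_eq_zero f μ hφ]
      exact iInf₂_le xstar hA
    have hcle : ∀ x ∈ A, (c : EReal) ≤ penaltyFun f φ μ x := fun x hx =>
      hc ▸ iInf₂_le x hx
    rw [hc, ← EReal.coe_sub, ← EReal.coe_div, ← EReal.coe_add,
      ← EReal.coe_strictMono.monotone.map_max, EReal.coe_le_coe_iff]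
    exact csInf_le ⟨0, fun _ h => h.1⟩
      ⟨le_max_of_le_left (leastExactOnParam_nonneg f φ a _), fun t ht =>
        minimizers_penaltyFun_eq_of_max_lt hfbot hφnn hφ hA ha hδ hcle hex ht⟩
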